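/- Let φ : ℝ^d → ℝ be four times continuously differentiable with max_{|κ| ≤ 4} ‖∂_κ φ‖_p finite for all 1 ≤ p ≤ ∞. Then for all r, s ∈ [0, ∞) and all 1 ≤ p ≤ ∞: ‖ φ̄̄(·, r, s) − φ − ((r² + s²)/(2(d+2))) Δφ ‖_p ≤ (d³/6) (r⁴ + s⁴) max_{|κ|=4} ‖∂_κ φ‖_p, where Δφ denotes the Laplacian of φ. -/

import Mathlib

open MeasureTheory Metric Set
open scoped ENNReal Classical

noncomputable section

/-- Euclidean space `ℝ^d`. -/
abbrev Euc (d : ℕ) : Type := EuclideanSpace ℝ (Fin d)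

/-- The ball average `φ̄(x,r) = (1/V_r) ∫_{B(x,r)} φ(y) dy` (with `φ̄(x,0) = φ(x)`). -/
def ballAvg {d : ℕ} (φ : Euc d → ℝ) (r : ℝ) (x : Euc d) : ℝ :=
  if r = 0 then φ x
  else ((volume (Metric.ball x r)).toReal)⁻¹ * ∫ y in Metric.ball x r, φ y

/-- The double ball average
`φ̄̄(x,r,s) = (1/(V_r V_s)) ∫_{B(x,r)} ∫_{B(y,s)} φ(z) dz dy` (equal to `φ` when a radius
vanishes). -/
def doubleAvg {d : ℕ} (φ : Euc d → ℝ) (r s : ℝ) (x : Euc d) : ℝ :=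
  ballAvg (ballAvg φ s) r x

/-- Partial derivative of `ψ` in the `i`-th coordinate direction. -/
def pd {d : ℕ} (i : Fin d) (ψ : Euc d → ℝ) (x : Euc d) : ℝ :=
  fderiv ℝ ψ x (EuclideanSpace.single i 1)

/-- Iterated partial derivative `∂_κ` along a list of coordinate directions. -/
def listD {d : ℕ} : List (Fin d) → (Euc d → ℝ) → Euc d → ℝ
  | [], ψ => ψ
  | i :: l, ψ => pd i (listD l ψ)

/-- The Laplacian `Δφ = ∑ i ∂²φ/∂x_i²`. -/
def lap {d : ℕ} (φ : Euc d → ℝ) (x : Euc d) : ℝ := ∑ i : Fin d, listD [i, i] φ x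

theorem mink {E Ω : Type*} [NormedAddCommGroup E] [MeasurableSpace E] [BorelSpace E] [SecondCountableTopology E] (v : Measure E) [SFinite v] [v.IsAddRightInvariant]
  [MeasurableSpace Ω] (ρ : Measure Ω) [SFinite ρ] (τ : Ω → E) (hτ : Measurable τ)
  (g : E → ℝ≥0∞) (hg : Measurable g) (p : ℝ≥0∞) (hp : 1 ≤ p) :
  eLpNorm (fun x => ∫⁻ ω, g (x + τ ω) ∂ρ) p v ≤ ρ univ * eLpNorm g p v := by
  have hj : Measurable (fun q : E × Ω => g (q.1 + τ q.2)) := by fun_prop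
  have hj2 : Measurable (fun q : Ω × E => g (q.2 + τ q.1)) := by fun_prop
  rcases eq_or_ne p ⊤ with rfl | hpt
  · simp only [eLpNorm_exponent_top, eLpNormEssSup]
    refine essSup_le_of_ae_le _ ?_
    set C := essSup (fun x => ‖g x‖ₑ) v with hC
    have h0 : ∀ᵐ x ∂v, g x ≤ C := by
      have := ae_le_essSup (μ := v) (f := fun x => ‖g x‖ₑ)
      filter_upwards [this] with x hx
      simpa [hC] using hx
    have h1 : ∀ᵐ ω ∂ρ, ∀ᵐ x ∂v, g (x + τ ω) ≤ C := by
      refine Filter.Eventually.of_forall fun ω => ?_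
      exact (measurePreserving_add_right v (τ ω)).quasiMeasurePreserving.ae h0
    have h2 : ∀ᵐ x ∂v, ∀ᵐ ω ∂ρ, g (x + τ ω) ≤ C := by
      rw [Measure.ae_ae_comm]
      · exact h1
      · exact measurableSet_le hj measurable_const
    filter_upwards [h2] with x hx
    simp only [enorm_eq_self]
    calc _ ≤ ∫⁻ ω, C ∂ρ := lintegral_mono_ae hx
      _ = _ := by simp [mul_comm]
  · have hp0 : p ≠ 0 := by rintro rfl; simp at hp
    set q := p.toReal with hq
    have hq1 : 1 ≤ q := by
      simpa using ENNReal.toReal_mono hpt hp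
    have hq0 : 0 < q := by linarith
    rw [eLpNorm_eq_lintegral_rpow_enorm_toReal hp0 hpt, eLpNorm_eq_lintegral_rpow_enorm_toReal hp0 hpt]
    simp only [enorm_eq_self, ← hq]
    have jensen : ∀ x, (∫⁻ ω, g (x + τ ω) ∂ρ) ^ q ≤ ρ univ ^ (q - 1) * ∫⁻ ω, g (x + τ ω) ^ q ∂ρ := by
      intro x
      rcases eq_or_lt_of_le hq1 with h | h
      · simp [← h]
      · have hol : q.HolderConjugate (q.conjExponent) := Real.HolderConjugate.conjExponent h
        have := ENNReal.lintegral_mul_le_Lp_mul_Lq ρ hol (f := fun ω => g (x + τ ω)) (g := fun _ => 1) (by fun_prop) (by fun_prop)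
        simp only [Pi.mul_apply, mul_one, ENNReal.one_rpow, lintegral_one] at this
        calc _ ≤ _ := ENNReal.rpow_le_rpow this hq0.le
          _ = _ := by
            rw [ENNReal.mul_rpow_of_nonneg _ _ hq0.le, ← ENNReal.rpow_mul, ← ENNReal.rpow_mul, mul_comm]
            have e1 : 1 / q * q = 1 := by field_simp
            have e2 : 1 / q.conjExponent * q = q - 1 := by
              unfold Real.conjExponent
              have : q - 1 ≠ 0 := by linarith
              field_simp
            rw [e1, e2, ENNReal.rpow_one]
    have key : ∫⁻ x, (∫⁻ ω, g (x + τ ω) ∂ρ) ^ q ∂v ≤ ρ univ ^ q * ∫⁻ x, g x ^ q ∂v := by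
      calc _ ≤ ∫⁻ x, ρ univ ^ (q - 1) * ∫⁻ ω, g (x + τ ω) ^ q ∂ρ ∂v := lintegral_mono jensen
        _ = ρ univ ^ (q - 1) * ∫⁻ x, ∫⁻ ω, g (x + τ ω) ^ q ∂ρ ∂v := by
          rw [lintegral_const_mul]
          exact (hj.pow_const q).lintegral_prod_right'
        _ = ρ univ ^ (q - 1) * ∫⁻ ω, ∫⁻ x, g (x + τ ω) ^ q ∂v ∂ρ := by
          rw [lintegral_lintegral_swap]
          exact (hj.pow_const q).aemeasurable
        _ = ρ univ ^ (q - 1) * (ρ univ * ∫⁻ x, g x ^ q ∂v) := by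
          congr 1
          simp_rw [fun ω => lintegral_add_right_eq_self (μ := v) (fun x => g x ^ q) (τ ω)]
          rw [lintegral_const, mul_comm]
        _ = _ := by
          rw [← mul_assoc]
          congr 1
          nth_rewrite 2 [← ENNReal.rpow_one (ρ univ)]
          rw [← ENNReal.rpow_add_of_nonneg _ _ (by linarith) (by norm_num)]
          congr 1; ring
    calc _ ≤ _ := ENNReal.rpow_le_rpow key (by positivity)
      _ = _ := by
        rw [ENNReal.mul_rpow_of_nonneg _ _ (by positivity), ← ENNReal.rpow_mul]
        rw [mul_one_div_cancel hq0.ne', ENNReal.rpow_one]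

theorem taylor4 (f0 f1 f2 f3 f4 : ℝ → ℝ) (h0 : ∀ t, HasDerivAt f0 (f1 t) t) (h1 : ∀ t, HasDerivAt f1 (f2 t) t)
   (h2 : ∀ t, HasDerivAt f2 (f3 t) t) (h3 : ∀ t, HasDerivAt f3 (f4 t) t) (h4 : Continuous f4) :
   f0 1 - f0 0 - f1 0 - f2 0 / 2 - f3 0 / 6 = ∫ t in Ioc (0:ℝ) 1, (1 - t) ^ 3 / 6 * f4 t := by
  rw [← intervalIntegral.integral_of_le zero_le_one]
  have hd : ∀ t : ℝ, HasDerivAt (fun t => f0 t + (1 - t) * f1 t + (1-t)^2/2 * f2 t + (1-t)^3/6 * f3 t) ((1 - t) ^ 3 / 6 * f4 t) t := by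
    intro t
    have hl : HasDerivAt (fun t : ℝ => 1 - t) (-1) t := by simpa using (hasDerivAt_id t).const_sub 1
    have := (((h0 t).add (hl.mul (h1 t))).add (((hl.pow 2).div_const 2).mul (h2 t))).add (((hl.pow 3).div_const 6).mul (h3 t))
    refine this.congr_deriv ?_
    simp
    ring
  rw [intervalIntegral.integral_eq_sub_of_hasDerivAt (fun t _ => hd t)]
  · simp; ring
  · exact Continuous.intervalIntegrable (by fun_prop) _ _

theorem pd_contDiff {d : ℕ} (i : Fin d) {n : ℕ} {ψ : Euc d → ℝ} (h : ContDiff ℝ (n + 1 : ℕ) ψ) :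
    ContDiff ℝ n (pd i ψ) := by
  unfold pd
  have := h.fderiv_right (m := n) (by norm_cast)
  exact this.clm_apply contDiff_const

theorem line_deriv {d : ℕ} {ψ : Euc d → ℝ} {n : ℕ} (h : ContDiff ℝ (n + 1 : ℕ) ψ) (x z : Euc d) (t : ℝ) :
    HasDerivAt (fun t : ℝ => ψ (x + t • z)) (∑ i, z i * pd i ψ (x + t • z)) t := by
  have hd : DifferentiableAt ℝ ψ (x + t • z) := (h.differentiable (by norm_cast)) _
  have h1 : HasDerivAt (fun t : ℝ => x + t • z) z t := by
    simpa using ((hasDerivAt_id t).smul_const z).const_add x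
  have h2 := hd.hasFDerivAt.comp_hasDerivAt t h1
  refine h2.congr_deriv ?_
  have hz : z = ∑ i, z i • (EuclideanSpace.single i (1:ℝ) : Euc d) := by
    ext j
    simp [Finset.sum_apply, Pi.single_apply]
  unfold pd
  generalize fderiv ℝ ψ (x + t • z) = L
  conv_lhs => rw [hz]
  rw [map_sum]
  simp

theorem taylor_multi {d : ℕ} {φ : Euc d → ℝ} (hφ : ContDiff ℝ 4 φ) (x z : Euc d) :
    φ (x + z) - φ x - (∑ i, z i * listD [i] φ x) - (∑ i, ∑ j, z i * z j * listD [j, i] φ x) / 2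
      - (∑ i, ∑ j, ∑ k, z i * z j * z k * listD [k, j, i] φ x) / 6
      = ∫ t in Ioc (0:ℝ) 1, (1 - t) ^ 3 / 6 *
        ∑ i, ∑ j, ∑ k, ∑ l, z i * z j * z k * z l * listD [l, k, j, i] φ (x + t • z) := by
  have c0 : ContDiff ℝ (3 + 1 : ℕ) φ := hφ
  have c1 : ∀ i, ContDiff ℝ (2 + 1 : ℕ) (listD [i] φ) := fun i => pd_contDiff i c0
  have c2 : ∀ i j, ContDiff ℝ (1 + 1 : ℕ) (listD [j, i] φ) := fun i j => pd_contDiff j (c1 i)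
  have c3 : ∀ i j k, ContDiff ℝ (0 + 1 : ℕ) (listD [k, j, i] φ) := fun i j k => pd_contDiff k (c2 i j)
  have c4 : ∀ i j k l, ContDiff ℝ (0 : ℕ) (listD [l, k, j, i] φ) := fun i j k l => pd_contDiff l (c3 i j k)
  have c4' : ∀ i j k l, Continuous (listD [l, k, j, i] φ) := fun i j k l => (c4 i j k l).continuous
  have := taylor4 (fun t => φ (x + t • z)) (fun t => ∑ i, z i * listD [i] φ (x + t • z))
    (fun t => ∑ i, ∑ j, z i * z j * listD [j, i] φ (x + t • z))
    (fun t => ∑ i, ∑ j, ∑ k, z i * z j * z k * listD [k, j, i] φ (x + t • z))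
    (fun t => ∑ i, ∑ j, ∑ k, ∑ l, z i * z j * z k * z l * listD [l, k, j, i] φ (x + t • z))
    (fun t => line_deriv c0 x z t) ?_ ?_ ?_ ?_
  · simpa using this
  · intro t
    refine HasDerivAt.fun_sum fun i _ => ?_
    refine ((line_deriv (c1 i) x z t).const_mul (z i)).congr_deriv ?_
    rw [Finset.mul_sum]
    exact Finset.sum_congr rfl fun j _ => by rw [← mul_assoc]; rfl
  · intro t
    refine HasDerivAt.fun_sum fun i _ => HasDerivAt.fun_sum fun j _ => ?_
    refine ((line_deriv (c2 i j) x z t).const_mul (z i * z j)).congr_deriv ?_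
    rw [Finset.mul_sum]
    exact Finset.sum_congr rfl fun j _ => by rw [← mul_assoc]; rfl
  · intro t
    refine HasDerivAt.fun_sum fun i _ => HasDerivAt.fun_sum fun j _ => HasDerivAt.fun_sum fun k _ => ?_
    refine ((line_deriv (c3 i j k) x z t).const_mul (z i * z j * z k)).congr_deriv ?_
    rw [Finset.mul_sum]
    exact Finset.sum_congr rfl fun j _ => by rw [← mul_assoc]; rfl
  · have : ∀ i j k l, Continuous fun t : ℝ => listD [l, k, j, i] φ (x + t • z) := fun i j k l =>
      (c4' i j k l).comp (by fun_prop)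
    fun_prop

theorem integrable_of_cont {d : ℕ} (m : Measure (Euc d)) [IsFiniteMeasure m] (R : ℝ)
    (hR : ∀ᵐ z ∂m, ‖z‖ ≤ R) (f : Euc d → ℝ) (hf : Continuous f) : Integrable f m := by
  obtain ⟨C, hC⟩ := (isCompact_closedBall (0 : Euc d) R).exists_bound_of_continuousOn hf.continuousOn
  refine Integrable.of_bound hf.aestronglyMeasurable C ?_
  filter_upwards [hR] with z hz
  exact hC z (by simpa using hz)

theorem integral_odd {d : ℕ} (m : Measure (Euc d)) [m.IsNegInvariant] (f : Euc d → ℝ)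
    (hf : ∀ z, f (-z) = - f z) : ∫ z, f z ∂m = 0 := by
  have := integral_neg_eq_self f m
  simp_rw [hf] at this
  rw [integral_neg] at this
  linarith

theorem l1_pow {d : ℕ} (z : Euc d) : (∑ i, |z i|) ^ 4 ≤ (d : ℝ) ^ 2 * ‖z‖ ^ 4 := by
  have h1 : (∑ i, |z i|) ^ 2 ≤ d * ‖z‖ ^ 2 := by
    have := sq_sum_le_card_mul_sum_sq (s := Finset.univ) (f := fun i => |z i|)
    rw [EuclideanSpace.norm_sq_eq]
    simpa using this
  calc _ = ((∑ i, |z i|) ^ 2) ^ 2 := by ring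
    _ ≤ (d * ‖z‖ ^ 2) ^ 2 := by gcongr
    _ = _ := by ring

theorem main_meas {d : ℕ} {φ : Euc d → ℝ} (hφ : ContDiff ℝ 4 φ) (m : Measure (Euc d))
    [IsProbabilityMeasure m] [m.IsNegInvariant] (R : ℝ) (hR : ∀ᵐ z ∂m, ‖z‖ ≤ R) (σ K : ℝ)
    (hσ : ∀ i j, ∫ z, z i * z j ∂m = if i = j then σ else 0)
    (hK : ∫ z, ‖z‖ ^ 4 ∂m ≤ K) (p : ℝ≥0∞) (hp : 1 ≤ p) :
    eLpNorm (fun x => ∫ z, φ (x + z) ∂m - φ x - σ / 2 * lap φ x) p volume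
      ≤ ENNReal.ofReal ((d : ℝ) ^ 2 / 24 * K) *
        ⨆ (l : List (Fin d)) (_ : l.length = 4), eLpNorm (listD l φ) p volume := by
  have c4 : ∀ i j k l, Continuous (listD [l, k, j, i] φ) := fun i j k l =>
    (pd_contDiff (n := 0) l (pd_contDiff k (pd_contDiff j (pd_contDiff (n := 3) i hφ)))).continuous
  set M := ⨆ (l : List (Fin d)) (_ : l.length = 4), eLpNorm (listD l φ) p volume with hM
  let P : Measure (Euc d × ℝ) := m.prod (volume.restrict (Ioc (0:ℝ) 1))
  let ι := Fin d × Fin d × Fin d × Fin d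
  let w : ι → Euc d × ℝ → ℝ≥0∞ := fun I ω =>
    ‖(1 - ω.2) ^ 3 / 6 * (ω.1 I.1 * ω.1 I.2.1 * ω.1 I.2.2.1 * ω.1 I.2.2.2)‖ₑ
  let g : ι → Euc d → ℝ≥0∞ := fun I y => ‖listD [I.2.2.2, I.2.2.1, I.2.1, I.1] φ y‖ₑ
  have hw : ∀ I, Measurable (w I) := fun I => by fun_prop
  have hg : ∀ I, Measurable (g I) := fun I => (c4 _ _ _ _).measurable.enorm
  let τ : Euc d × ℝ → Euc d := fun ω => ω.2 • ω.1
  have hτ : Measurable τ := by fun_prop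
  have int := integrable_of_cont m R hR
  -- pointwise bound
  have pw : ∀ x, ‖∫ z, φ (x + z) ∂m - φ x - σ / 2 * lap φ x‖ₑ ≤
      ∑ I, ∫⁻ ω, g I (x + τ ω) ∂(P.withDensity (w I)) := by
    intro x
    have e1 : ∫ z, φ (x + z) ∂m - φ x - σ / 2 * lap φ x =
      ∫ z, (φ (x + z) - φ x - (∑ i, z i * listD [i] φ x) - (∑ i, ∑ j, z i * z j * listD [j, i] φ x) / 2
      - (∑ i, ∑ j, ∑ k, z i * z j * z k * listD [k, j, i] φ x) / 6) ∂m := by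
      have hc := hφ.continuous
      rw [integral_sub (int _ (by fun_prop)) (int _ (by fun_prop)),
        integral_sub (int _ (by fun_prop)) (int _ (by fun_prop)),
        integral_sub (int _ (by fun_prop)) (int _ (by fun_prop)),
        integral_sub (int _ (by fun_prop)) (int _ (by fun_prop))]
      rw [integral_odd m (fun z => ∑ i, z i * listD [i] φ x) (by intro z; simp),
        integral_odd m (fun z => (∑ i, ∑ j, ∑ k, z i * z j * z k * listD [k, j, i] φ x) / 6)
          (by intro z; simp [neg_div])]
      have e2 : ∫ z, (∑ i, ∑ j, z i * z j * listD [j, i] φ x) / 2 ∂m = σ / 2 * lap φ x := by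
        rw [integral_div, integral_finsetSum _ (fun i _ => int _ (by fun_prop))]
        have : ∀ i, ∫ z, ∑ j, z i * z j * listD [j, i] φ x ∂m = σ * listD [i, i] φ x := by
          intro i
          rw [integral_finsetSum _ (fun i _ => int _ (by fun_prop))]
          simp_rw [integral_mul_const, hσ]
          simp
        simp_rw [this]
        rw [← Finset.mul_sum]
        unfold lap
        ring
      rw [e2]
      simp
    rw [e1]
    calc _ ≤ ∫⁻ z, ‖_‖ₑ ∂m := enorm_integral_le_lintegral_enorm _
      _ ≤ ∫⁻ z, ∫⁻ t in Ioc (0:ℝ) 1, ∑ I, w I (z, t) * g I (x + τ (z, t)) ∂volume ∂m := by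
        refine lintegral_mono fun z => ?_
        simp only
        rw [taylor_multi hφ]
        refine (enorm_integral_le_lintegral_enorm _).trans (lintegral_mono fun t => ?_)
        simp only
        rw [Finset.mul_sum]
        simp only [Finset.mul_sum]
        have : (∑ i, ∑ j, ∑ k, ∑ l, (1 - t) ^ 3 / 6 * (z i * z j * z k * z l * listD [l, k, j, i] φ (x + t • z)))
          = ∑ I : ι, (1 - t) ^ 3 / 6 * (z I.1 * z I.2.1 * z I.2.2.1 * z I.2.2.2) * listD [I.2.2.2, I.2.2.1, I.2.1, I.1] φ (x + t • z) := by
          simp only [ι, Fintype.sum_prod_type, mul_assoc]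
        rw [this]
        refine (enorm_sum_le _ _).trans (le_of_eq ?_)
        refine Finset.sum_congr rfl fun I _ => ?_
        rw [enorm_mul]
      _ = ∫⁻ ω, ∑ I, w I ω * g I (x + τ ω) ∂P := by
        rw [lintegral_prod]
        have : ∀ I, Measurable fun ω => g I (x + τ ω) := fun I => (hg I).comp (by fun_prop)
        fun_prop
      _ = _ := by
        have : ∀ I, Measurable fun ω => g I (x + τ ω) := fun I => (hg I).comp (by fun_prop)
        rw [lintegral_finsetSum _ (fun I _ => by fun_prop)]
        refine Finset.sum_congr rfl fun I _ => ?_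
        rw [lintegral_withDensity_eq_lintegral_mul _ (hw I) (this I)]
        rfl
  have hgM : ∀ I, eLpNorm (g I) p volume ≤ M := by
    intro I
    have : eLpNorm (g I) p volume = eLpNorm (listD [I.2.2.2, I.2.2.1, I.2.1, I.1] φ) p volume :=
      eLpNorm_enorm _
    rw [this, hM]
    exact le_iSup₂_of_le _ rfl le_rfl
  have hwsum : ∑ I, ∫⁻ ω, w I ω ∂P ≤ ENNReal.ofReal ((d : ℝ) ^ 2 / 24 * K) := by
    rw [← lintegral_finsetSum _ (fun I _ => hw I), lintegral_prod _ (by fun_prop)]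
    have h1 : ∀ z : Euc d, ∫⁻ t in Ioc (0:ℝ) 1, ∑ I, w I (z, t) ≤ ENNReal.ofReal ((d : ℝ) ^ 2 / 24 * ‖z‖ ^ 4) := by
      intro z
      have h2 : ∀ t ∈ Ioc (0:ℝ) 1, ∑ I, w I (z, t) = ENNReal.ofReal ((1 - t) ^ 3 / 6 * (∑ i, |z i|) ^ 4) := by
        intro t ht
        have ht' : 0 ≤ 1 - t := by linarith [ht.2]
        have : (∑ i, |z i|) ^ 4 = ∑ I : ι, |z I.1| * |z I.2.1| * |z I.2.2.1| * |z I.2.2.2| := by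
          simp only [ι, Fintype.sum_prod_type, ← Finset.mul_sum, ← Finset.sum_mul]
          ring
        rw [this, Finset.mul_sum, ENNReal.ofReal_sum_of_nonneg (fun I _ => by positivity)]
        refine Finset.sum_congr rfl fun I _ => ?_
        simp only [w]
        rw [← ofReal_norm]
        simp only [norm_mul, Real.norm_eq_abs]
        rw [abs_of_nonneg (by positivity : 0 ≤ (1 - t) ^ 3 / 6)]
      rw [setLIntegral_congr_fun measurableSet_Ioc h2]
      rw [← ofReal_integral_eq_lintegral_ofReal]
      · apply ENNReal.ofReal_le_ofReal
        rw [integral_mul_const, ← intervalIntegral.integral_of_le zero_le_one]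
        have : ∫ t in (0:ℝ)..1, (1 - t) ^ 3 / 6 = 1 / 24 := by
          rw [intervalIntegral.integral_comp_sub_left (fun t => t ^ 3 / 6) 1]
          simp [intervalIntegral.integral_div]
          norm_num
        rw [this]
        linarith [l1_pow z]
      · exact (Continuous.integrableOn_Icc (by fun_prop)).mono_set Ioc_subset_Icc_self
      · filter_upwards [ae_restrict_mem measurableSet_Ioc] with t ht
        have ht' : 0 ≤ 1 - t := by linarith [ht.2]
        positivity
    refine (lintegral_mono h1).trans ?_
    rw [← ofReal_integral_eq_lintegral_ofReal (int _ (by fun_prop)) (Filter.Eventually.of_forall fun z => by positivity)]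
    apply ENNReal.ofReal_le_ofReal
    rw [integral_const_mul]
    gcongr
  calc _ ≤ eLpNorm (∑ I, fun x => ∫⁻ ω, g I (x + τ ω) ∂(P.withDensity (w I))) p volume := by
        refine eLpNorm_mono_enorm fun x => (pw x).trans (le_of_eq ?_)
        simp
    _ ≤ ∑ I, eLpNorm (fun x => ∫⁻ ω, g I (x + τ ω) ∂(P.withDensity (w I))) p volume := by
        refine eLpNorm_sum_le (fun I _ => ?_) hp
        have : Measurable fun q : Euc d × (Euc d × ℝ) => g I (q.1 + τ q.2) := (hg I).comp (by fun_prop)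
        exact this.lintegral_prod_right'.aestronglyMeasurable
    _ ≤ ∑ I, (∫⁻ ω, w I ω ∂P) * M := by
        refine Finset.sum_le_sum fun I _ => ?_
        refine (mink volume _ τ hτ (g I) (hg I) p hp).trans ?_
        rw [withDensity_apply _ MeasurableSet.univ, Measure.restrict_univ]
        gcongr
        exact hgM I
    _ = (∑ I, ∫⁻ ω, w I ω ∂P) * M := by rw [Finset.sum_mul]
    _ ≤ _ := by gcongr

/-- The uniform probability measure on the ball of radius `r` (a Dirac mass if `r = 0`). -/
def bm (d : ℕ) (r : ℝ) : Measure (Euc d) :=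
  if r = 0 then Measure.dirac 0 else (volume (ball (0 : Euc d) r))⁻¹ • volume.restrict (ball 0 r)

theorem bm_prob {d : ℕ} {r : ℝ} (hr : 0 ≤ r) : IsProbabilityMeasure (bm d r) := by
  unfold bm
  split_ifs with h
  · infer_instance
  · constructor
    have hr' : 0 < r := lt_of_le_of_ne hr (Ne.symm h)
    simp only [Measure.smul_apply, Measure.restrict_apply MeasurableSet.univ, univ_inter, smul_eq_mul]
    exact ENNReal.inv_mul_cancel (measure_ball_pos _ _ hr').ne' measure_ball_lt_top.ne

theorem bm_integral {d : ℕ} {r : ℝ} (h : r ≠ 0) (f : Euc d → ℝ) :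
    ∫ y, f y ∂(bm d r) = ((volume (ball (0 : Euc d) r)).toReal)⁻¹ * ∫ y in ball 0 r, f y := by
  unfold bm
  rw [if_neg h, integral_smul_measure, ENNReal.toReal_inv, smul_eq_mul]

theorem ballAvg_eq {d : ℕ} (r : ℝ) (φ : Euc d → ℝ) (x : Euc d) :
    ballAvg φ r x = ∫ y, φ (x + y) ∂(bm d r) := by
  by_cases h : r = 0
  · simp [ballAvg, bm, h]
  · rw [bm_integral h]
    unfold ballAvg
    rw [if_neg h]
    have hpre : (fun y => x + y) ⁻¹' (ball x r) = ball (0 : Euc d) r := by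
      ext y; simp
    have h1 := (measurePreserving_add_left (volume : Measure (Euc d)) x).setIntegral_preimage_emb
      (measurableEmbedding_addLeft x) φ (ball x r)
    rw [hpre] at h1
    rw [h1, Measure.addHaar_ball_center]

theorem bm_supp {d : ℕ} {r : ℝ} (hr : 0 ≤ r) : ∀ᵐ y ∂(bm d r), ‖y‖ ≤ r := by
  unfold bm
  split_ifs with h
  · rw [ae_dirac_eq]
    simpa using hr
  · refine Measure.ae_smul_measure ?_ _
    filter_upwards [ae_restrict_mem measurableSet_ball] with y hy
    simpa using (mem_ball_zero_iff.1 hy).le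

theorem bm_map {d : ℕ} (r : ℝ) (T : Euc d ≃ₗᵢ[ℝ] Euc d) : (bm d r).map T = bm d r := by
  have hT : Measurable T := T.continuous.measurable
  unfold bm
  split_ifs with h
  · rw [Measure.map_dirac' hT]
    simp
  · rw [Measure.map_smul]
    congr 1
    have hpre : T ⁻¹' (ball 0 r) = ball (0 : Euc d) r := by
      ext y; simp
    have := (T.measurePreserving).restrict_preimage (s := ball 0 r) measurableSet_ball
    rw [hpre] at this
    exact this.map_eq

theorem bm_comp {d : ℕ} (r : ℝ) (T : Euc d ≃ₗᵢ[ℝ] Euc d) (f : Euc d → ℝ) (hf : Continuous f) :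
    ∫ y, f (T y) ∂(bm d r) = ∫ y, f y ∂(bm d r) := by
  conv_rhs => rw [← bm_map r T]
  rw [integral_map T.continuous.measurable.aemeasurable hf.aestronglyMeasurable]

theorem bm_neg {d : ℕ} (r : ℝ) : (bm d r).IsNegInvariant := by
  constructor
  exact bm_map r (LinearIsometryEquiv.neg ℝ)

theorem bm_offdiag {d : ℕ} (r : ℝ) (i j : Fin d) (hij : i ≠ j) : ∫ y, y i * y j ∂(bm d r) = 0 := by
  have := bm_comp r (LinearIsometryEquiv.piLpCongrRight 2
    (fun k : Fin d => if k = i then LinearIsometryEquiv.neg ℝ else LinearIsometryEquiv.refl ℝ ℝ))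
    (fun y => y i * y j) (by fun_prop)
  simp [hij.symm, integral_neg] at this
  linarith

theorem bm_diag_eq {d : ℕ} (r : ℝ) (i j : Fin d) :
    ∫ y, y i * y i ∂(bm d r) = ∫ y, y j * y j ∂(bm d r) := by
  have := bm_comp r (LinearIsometryEquiv.piLpCongrLeft 2 ℝ ℝ (Equiv.swap i j))
    (fun y => y i * y i) (by fun_prop)
  rw [← this]
  simp [LinearIsometryEquiv.piLpCongrLeft_apply]

theorem bm_normsq {d : ℕ} (hd : 0 < d) {r : ℝ} (hr : 0 ≤ r) :
    ∫ y, ‖y‖ ^ 2 ∂(bm d r) = d * (r ^ 2 / (d + 2)) := by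
  by_cases h : r = 0
  · simp [bm, h]
  have hr' : 0 < r := lt_of_le_of_ne hr (Ne.symm h)
  have : Nonempty (Fin d) := ⟨⟨0, hd⟩⟩
  rw [bm_integral h]
  have e1 : ∫ y in ball (0 : Euc d) r, ‖y‖ ^ 2 = ∫ y : Euc d, (Iio r).indicator (fun t : ℝ => t ^ 2) ‖y‖ := by
    rw [← integral_indicator measurableSet_ball]
    congr 1
    ext y
    simp [indicator]
  rw [e1, integral_fun_norm_addHaar]
  have e2 : ∫ y in Ioi (0:ℝ), y ^ (Module.finrank ℝ (Euc d) - 1) • (Iio r).indicator (fun t : ℝ => t ^ 2) y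
      = r ^ (d + 2) / (d + 2) := by
    have : ∀ y : ℝ, y ^ (Module.finrank ℝ (Euc d) - 1) • (Iio r).indicator (fun t : ℝ => t ^ 2) y =
        (Iio r).indicator (fun t : ℝ => t ^ (d + 1)) y := by
      intro y
      by_cases hy : y < r
      · simp [indicator, hy]
        rw [← pow_add]
        congr 1; omega
      · simp [indicator, hy]
    simp_rw [this]
    rw [setIntegral_indicator measurableSet_Iio, Ioi_inter_Iio, ← integral_Ioc_eq_integral_Ioo,
      ← intervalIntegral.integral_of_le hr, integral_pow]
    simp
    ring
  rw [e2, Measure.addHaar_ball _ _ hr, ENNReal.toReal_mul, ENNReal.toReal_ofReal (by positivity)]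
  have hv : 0 < (volume (ball (0 : Euc d) 1)).toReal :=
    ENNReal.toReal_pos (measure_ball_pos _ _ one_pos).ne' measure_ball_lt_top.ne
  simp only [Measure.real, finrank_euclideanSpace, Fintype.card_fin, nsmul_eq_mul, smul_eq_mul]
  field_simp
  ring

theorem bm_moment {d : ℕ} {r : ℝ} (hr : 0 ≤ r) (i j : Fin d) :
    ∫ y, y i * y j ∂(bm d r) = if i = j then r ^ 2 / (d + 2) else 0 := by
  have := bm_prob (d := d) hr
  split_ifs with h
  · subst h
    have hd : 0 < d := i.pos
    have h1 := bm_normsq hd hr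
    simp_rw [EuclideanSpace.norm_sq_eq] at h1
    rw [integral_finsetSum _ (fun i _ => integrable_of_cont _ r (bm_supp hr) _ (by fun_prop))] at h1
    have h2 : ∀ k : Fin d, ∫ y, ‖y k‖ ^ 2 ∂(bm d r) = ∫ y, y i * y i ∂(bm d r) := by
      intro k
      rw [← bm_diag_eq r k i]
      congr 1; ext y; simp [pow_two]
    simp_rw [h2] at h1
    simp only [Finset.sum_const, Finset.card_univ, Fintype.card_fin, nsmul_eq_mul] at h1
    exact mul_left_cancel₀ (by positivity) h1
  · exact bm_offdiag r i j h

theorem four_bound {E : Type*} [NormedAddCommGroup E] [InnerProductSpace ℝ E] (x y : E) (r s : ℝ)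
    (hx : ‖x‖ ≤ r) (hy : ‖y‖ ≤ s) :
    ‖x + y‖ ^ 4 + ‖x + -y‖ ^ 4 ≤ 8 * (r ^ 4 + s ^ 4) := by
  have h1 := norm_add_sq_real x y
  have h2 := norm_sub_sq_real x y
  have h3 := abs_real_inner_le_norm x y
  rw [← sub_eq_add_neg]
  have e1 : ‖x + y‖ ^ 4 = (‖x‖ ^ 2 + 2 * inner ℝ x y + ‖y‖ ^ 2) ^ 2 := by rw [← h1]; ring
  have e2 : ‖x - y‖ ^ 4 = (‖x‖ ^ 2 - 2 * inner ℝ x y + ‖y‖ ^ 2) ^ 2 := by rw [← h2]; ring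
  have h4 : (inner ℝ x y : ℝ) ^ 2 ≤ (‖x‖ * ‖y‖) ^ 2 := by
    rw [← sq_abs]; gcongr
  have h5 : ‖x‖ ^ 4 ≤ r ^ 4 := by gcongr
  have h6 : ‖y‖ ^ 4 ≤ s ^ 4 := by gcongr
  rw [e1, e2]
  nlinarith [sq_nonneg (‖x‖ ^ 2 - ‖y‖ ^ 2)]

theorem main_thm {d : ℕ} (φ : Euc d → ℝ) (hφ : ContDiff ℝ 4 φ) (r s : ℝ) (hr : 0 ≤ r) (hs : 0 ≤ s)
    (p : ℝ≥0∞) (hp : 1 ≤ p) :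
      eLpNorm (fun x =>
          doubleAvg φ r s x - φ x - (r ^ 2 + s ^ 2) / (2 * ((d : ℝ) + 2)) * lap φ x) p volume
        ≤ ENNReal.ofReal ((d : ℝ) ^ 3 / 6 * (r ^ 4 + s ^ 4)) *
            ⨆ (l : List (Fin d)) (_ : l.length = 4), eLpNorm (listD l φ) p volume := by
  have := bm_prob (d := d) hr
  have := bm_prob (d := d) hs
  have := bm_neg (d := d) r
  have := bm_neg (d := d) s
  set μ := bm d r with hμ
  set ν := bm d s with hν
  have sμ : ∀ᵐ y ∂μ, ‖y‖ ≤ r := bm_supp hr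
  have sν : ∀ᵐ y ∂ν, ‖y‖ ≤ s := bm_supp hs
  have iμ := integrable_of_cont μ r sμ
  have iν := integrable_of_cont ν s sν
  let m : Measure (Euc d) := μ ∗ ν
  have : IsProbabilityMeasure m := inferInstanceAs (IsProbabilityMeasure (μ ∗ ν))
  have hR : ∀ᵐ z ∂m, ‖z‖ ≤ r + s := by
    have : ∀ᵐ q ∂(μ.prod ν), ‖q.1 + q.2‖ ≤ r + s := by
      rw [Measure.ae_prod_iff_ae_ae (measurableSet_le (by fun_prop) (by fun_prop))]
      filter_upwards [sμ] with x hx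
      filter_upwards [sν] with y hy
      exact (norm_add_le _ _).trans (add_le_add hx hy)
    exact (ae_map_iff (by fun_prop) (measurableSet_le (by fun_prop) (by fun_prop))).2 this
  have im := integrable_of_cont m _ hR
  have cv : ∀ f : Euc d → ℝ, Continuous f → ∫ z, f z ∂m = ∫ x, ∫ y, f (x + y) ∂ν ∂μ :=
    fun f hf => integral_conv (im f hf)
  have : m.IsNegInvariant := by
    constructor
    have := Measure.map_conv_continuousLinearMap (μ := μ) (ν := ν) (-(ContinuousLinearMap.id ℝ (Euc d)))
    have n1 : Measure.map (⇑(-(ContinuousLinearMap.id ℝ (Euc d)))) μ = μ := Measure.IsNegInvariant.neg_eq_self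
    have n2 : Measure.map (⇑(-(ContinuousLinearMap.id ℝ (Euc d)))) ν = ν := Measure.IsNegInvariant.neg_eq_self
    rw [n1, n2] at this
    exact this
  have hσ : ∀ i j, ∫ z, z i * z j ∂m = if i = j then (r ^ 2 + s ^ 2) / (d + 2) else 0 := by
    intro i j
    rw [cv _ (by fun_prop)]
    have z1 : ∀ i, ∫ y, y i ∂μ = 0 := fun i => integral_odd μ (fun y => y i) (by simp)
    have z2 : ∀ i, ∫ y, y i ∂ν = 0 := fun i => integral_odd ν (fun y => y i) (by simp)
    have : ∀ x : Euc d, ∫ y, (x + y) i * (x + y) j ∂ν = x i * x j + ∫ y, y i * y j ∂ν := by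
      intro x
      have e : ∀ y : Euc d, (x + y) i * (x + y) j = x i * x j + x i * y j + y i * x j + y i * y j := by
        intro y; simp; ring
      simp_rw [e]
      rw [integral_add (iν _ (by fun_prop)) (iν _ (by fun_prop)),
        integral_add (iν _ (by fun_prop)) (iν _ (by fun_prop)),
        integral_add (iν _ (by fun_prop)) (iν _ (by fun_prop)), integral_const_mul (x i) (fun y : Euc d => y j), integral_mul_const (x j) (fun y : Euc d => y i), z2, z2]
      simp
    simp_rw [this]
    rw [integral_add (iμ _ (by fun_prop)) (iμ _ (by fun_prop)), hμ, hν, bm_moment hr, bm_moment hs]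
    split_ifs
    · simp [← hμ]; ring
    · simp
  have hK : ∫ z, ‖z‖ ^ 4 ∂m ≤ 4 * (r ^ 4 + s ^ 4) := by
    rw [cv _ (by fun_prop)]
    have h1 : ∀ᵐ x ∂μ, ∫ y, ‖x + y‖ ^ 4 ∂ν ≤ 4 * (r ^ 4 + s ^ 4) := by
      filter_upwards [sμ] with x hx
      have h2 := integral_neg_eq_self (fun y => ‖x + y‖ ^ 4) ν
      have h3 : ∫ y, (‖x + y‖ ^ 4 + ‖x + -y‖ ^ 4) ∂ν ≤ 8 * (r ^ 4 + s ^ 4) := by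
        have : ∫ y, (‖x + y‖ ^ 4 + ‖x + -y‖ ^ 4) ∂ν ≤ ∫ y, 8 * (r ^ 4 + s ^ 4) ∂ν := by
          refine integral_mono_ae (iν _ (by fun_prop)) (iν _ (by fun_prop)) ?_
          filter_upwards [sν] with y hy
          exact four_bound x y r s hx hy
        simpa using this
      rw [integral_add (iν _ (by fun_prop)) (iν _ (by fun_prop)), h2] at h3
      linarith
    have h4 : ∫ x, ∫ y, ‖x + y‖ ^ 4 ∂ν ∂μ ≤ ∫ x, 4 * (r ^ 4 + s ^ 4) ∂μ := by
      refine integral_mono_of_nonneg (Filter.Eventually.of_forall fun x => integral_nonneg fun y => by positivity) (iμ _ (by fun_prop)) h1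
    simpa using h4
  have key := main_meas hφ m (r + s) hR _ _ hσ hK p hp
  have e : (fun x => doubleAvg φ r s x - φ x - (r ^ 2 + s ^ 2) / (2 * ((d : ℝ) + 2)) * lap φ x) =
      fun x => ∫ z, φ (x + z) ∂m - φ x - (r ^ 2 + s ^ 2) / (d + 2) / 2 * lap φ x := by
    ext x
    have hc := hφ.continuous
    rw [cv (fun z => φ (x + z)) (by fun_prop)]
    unfold doubleAvg
    rw [ballAvg_eq]
    simp_rw [ballAvg_eq, add_assoc]
    rw [div_div, mul_comm (2:ℝ)]
  rw [e]
  refine key.trans (mul_le_mul_left (ENNReal.ofReal_le_ofReal ?_) _)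
  rcases Nat.eq_zero_or_pos d with h | h
  · subst h; simp
  · have h1 : (1:ℝ) ≤ d := by exact_mod_cast h
    have h2 : (d : ℝ) ^ 2 ≤ (d : ℝ) ^ 3 := pow_le_pow_right₀ h1 (by norm_num)
    have : 0 ≤ r ^ 4 + s ^ 4 := by positivity
    nlinarith

/-- for `φ` four times continuously differentiable with
`max_{|κ|≤4} ‖∂_κ φ‖_p` finite for all `1 ≤ p ≤ ∞`, for all `r, s ∈ [0,∞)` and `1 ≤ p ≤ ∞`,
`‖ φ̄̄(·, r, s) − φ − ((r²+s²)/(2(d+2))) Δφ ‖_p ≤ (d³/6)(r⁴+s⁴) max_{|κ|=4} ‖∂_κ φ‖_p`. -/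
theorem stmt7 {d : ℕ} (φ : Euc d → ℝ) (hφ : ContDiff ℝ 4 φ)
    (hfin : ∀ p : ℝ≥0∞, 1 ≤ p →
      (⨆ (l : List (Fin d)) (_ : l.length ≤ 4), eLpNorm (listD l φ) p volume) < ⊤) :
    ∀ r s : ℝ, 0 ≤ r → 0 ≤ s → ∀ p : ℝ≥0∞, 1 ≤ p →
      eLpNorm (fun x =>
          doubleAvg φ r s x - φ x - (r ^ 2 + s ^ 2) / (2 * ((d : ℝ) + 2)) * lap φ x) p volume
        ≤ ENNReal.ofReal ((d : ℝ) ^ 3 / 6 * (r ^ 4 + s ^ 4)) *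
            ⨆ (l : List (Fin d)) (_ : l.length = 4), eLpNorm (listD l φ) p volume := by
  intro r s hr hs p hp
  exact main_thm φ hφ r s hr hs p hp

end
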